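/- Let G_□ be the digraph with four vertices s, u, v, t and the five edges (s,u), (u,t), (s,v), (v,t), (s,t). In every planar straight-line drawing p of G_□ in which the direction vector of each edge is a positive scalar multiple of (1,0), of (1,1), or of (0,1), there exists a real number ℓ > 0 such that p t = p s + (ℓ, ℓ) and {p u, p v} = {p s + (ℓ, 0), p s + (0, ℓ)}. (In other words, up to scaling and mirroring along the diagonal axis, G_□ admits an upward planar 3-slope drawing only as a square with one diagonal.) -/

import Mathlib

open scoped Classical

/-- A straight-line drawing `p` of a digraph with edge set `E` is planar if it is injective,
any two distinct edge segments intersect exactly in the images of their common endpoints,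
and no vertex image lies on the segment of a non-incident edge. -/
def IsPlanarDrawing {V : Type*} (E : Finset (V × V)) (p : V → ℝ × ℝ) : Prop :=
  Function.Injective p ∧
  (∀ e ∈ E, ∀ f ∈ E, e ≠ f →
      segment ℝ (p e.1) (p e.2) ∩ segment ℝ (p f.1) (p f.2) =
        {x | (x = p e.1 ∨ x = p e.2) ∧ (x = p f.1 ∨ x = p f.2)}) ∧
  (∀ w : V, ∀ e ∈ E, w ≠ e.1 → w ≠ e.2 → p w ∉ segment ℝ (p e.1) (p e.2))

/-- The edge set of the digraph `G_□` on the vertices `s = 0`, `u = 1`, `v = 2`, `t = 3`: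
the five edges `(s,u), (u,t), (s,v), (v,t), (s,t)`. -/
def squareEdges : Finset (Fin 4 × Fin 4) :=
  {((0 : Fin 4), (1 : Fin 4)), ((1 : Fin 4), (3 : Fin 4)),
   ((0 : Fin 4), (2 : Fin 4)), ((2 : Fin 4), (3 : Fin 4)),
   ((0 : Fin 4), (3 : Fin 4))}

/-- If `b` is reached from `a` by a shorter positive multiple of `d` than `c` is,
then `b` lies on the segment from `a` to `c`. -/
lemma mem_segment_of_sub_eq_smul {E : Type*} [AddCommGroup E] [Module ℝ E] {a b c d : E}
    {r q : ℝ} (hr : 0 < r) (hrq : r ≤ q) (hb : b - a = r • d) (hc : c - a = q • d) :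
    b ∈ segment ℝ a c := by
  have hq : 0 < q := hr.trans_le hrq
  rw [segment_eq_image']
  refine ⟨r / q, ⟨by positivity, (div_le_one hq).2 hrq⟩, ?_⟩
  simp only [hc, smul_smul, div_mul_cancel₀ r hq.ne', ← hb, add_sub_cancel]

/-- Two distinct edges leaving the same vertex in a planar drawing have different directions. -/
lemma IsPlanarDrawing.not_same_direction {V : Type*} {E : Finset (V × V)} {p : V → ℝ × ℝ}
    (hp : IsPlanarDrawing E p) {a b c : V} (hab : (a, b) ∈ E) (hac : (a, c) ∈ E)
    (hba : b ≠ a) (hca : c ≠ a) (hbc : b ≠ c) {r q : ℝ} {d : ℝ × ℝ} (hr : 0 < r) (hq : 0 < q)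
    (hb : p b - p a = r • d) (hc : p c - p a = q • d) : False := by
  rcases le_total r q with h | h
  · exact hp.2.2 b (a, c) hac hba hbc (mem_segment_of_sub_eq_smul hr h hb hc)
  · exact hp.2.2 c (a, b) hab hca hbc.symm (mem_segment_of_sub_eq_smul hq h hc hb)

/-- The first step of a two-step path with horizontal displacement is horizontal. -/
lemma horizontal_of_sub_horizontal {s m t : ℝ × ℝ} {x y l : ℝ} (hx : 0 < x) (hy : 0 < y)
    (hu : m - s = x • ((1 : ℝ), (0 : ℝ)) ∨ m - s = x • ((1 : ℝ), (1 : ℝ)) ∨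
      m - s = x • ((0 : ℝ), (1 : ℝ)))
    (hv : t - m = y • ((1 : ℝ), (0 : ℝ)) ∨ t - m = y • ((1 : ℝ), (1 : ℝ)) ∨
      t - m = y • ((0 : ℝ), (1 : ℝ)))
    (ht : t - s = l • ((1 : ℝ), (0 : ℝ))) : m - s = x • ((1 : ℝ), (0 : ℝ)) := by
  rcases hu with hu | hu | hu <;> rcases hv with hv | hv | hv <;>
    first
    | exact hu
    | (simp [Prod.ext_iff] at hu hv ht; linarith)

/-- The first step of a two-step path with vertical displacement is vertical. -/
lemma vertical_of_sub_vertical {s m t : ℝ × ℝ} {x y l : ℝ} (hx : 0 < x) (hy : 0 < y)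
    (hu : m - s = x • ((1 : ℝ), (0 : ℝ)) ∨ m - s = x • ((1 : ℝ), (1 : ℝ)) ∨
      m - s = x • ((0 : ℝ), (1 : ℝ)))
    (hv : t - m = y • ((1 : ℝ), (0 : ℝ)) ∨ t - m = y • ((1 : ℝ), (1 : ℝ)) ∨
      t - m = y • ((0 : ℝ), (1 : ℝ)))
    (ht : t - s = l • ((0 : ℝ), (1 : ℝ))) : m - s = x • ((0 : ℝ), (1 : ℝ)) := by
  rcases hu with hu | hu | hu <;> rcases hv with hv | hv | hv <;>
    first
    | exact hu
    | (simp [Prod.ext_iff] at hu hv ht; linarith)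

/-- A two-step path with diagonal displacement that starts horizontally turns at a corner of
the square. -/
lemma eq_add_right_of_sub_diagonal {s m t : ℝ × ℝ} {x y l : ℝ} (hx : 0 < x) (hy : 0 < y)
    (hu : m - s = x • ((1 : ℝ), (0 : ℝ)))
    (hv : t - m = y • ((1 : ℝ), (0 : ℝ)) ∨ t - m = y • ((1 : ℝ), (1 : ℝ)) ∨
      t - m = y • ((0 : ℝ), (1 : ℝ)))
    (ht : t - s = l • ((1 : ℝ), (1 : ℝ))) : m = s + (l, 0) := by
  rcases hv with hv | hv | hv <;>
  · simp [Prod.ext_iff] at hu hv ht ⊢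
    constructor <;> linarith

/-- A two-step path with diagonal displacement that starts vertically turns at a corner of
the square. -/
lemma eq_add_up_of_sub_diagonal {s m t : ℝ × ℝ} {x y l : ℝ} (hx : 0 < x) (hy : 0 < y)
    (hu : m - s = x • ((0 : ℝ), (1 : ℝ)))
    (hv : t - m = y • ((1 : ℝ), (0 : ℝ)) ∨ t - m = y • ((1 : ℝ), (1 : ℝ)) ∨
      t - m = y • ((0 : ℝ), (1 : ℝ)))
    (ht : t - s = l • ((1 : ℝ), (1 : ℝ))) : m = s + (0, l) := by
  rcases hv with hv | hv | hv <;>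
  · simp [Prod.ext_iff] at hu hv ht ⊢
    constructor <;> linarith

/-- In every planar straight-line drawing of `G_□` whose edge direction vectors are positive
multiples of `(1,0)`, `(1,1)` or `(0,1)`, the drawing is (up to mirroring along the diagonal)
a square of some side length `ℓ > 0` with the diagonal `st`. -/
theorem square_gadget_rigid (p : Fin 4 → ℝ × ℝ)
    (hp : IsPlanarDrawing squareEdges p)
    (hslopes : ∀ e ∈ squareEdges, ∃ r : ℝ, 0 < r ∧
      (p e.2 - p e.1 = r • (((1 : ℝ), (0 : ℝ)) : ℝ × ℝ) ∨
       p e.2 - p e.1 = r • (((1 : ℝ), (1 : ℝ)) : ℝ × ℝ) ∨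
       p e.2 - p e.1 = r • (((0 : ℝ), (1 : ℝ)) : ℝ × ℝ))) :
    ∃ ℓ : ℝ, 0 < ℓ ∧ p 3 = p 0 + (ℓ, ℓ) ∧
      ({p 1, p 2} : Set (ℝ × ℝ)) = {p 0 + (ℓ, 0), p 0 + (0, ℓ)} := by
  have h01 : ((0 : Fin 4), (1 : Fin 4)) ∈ squareEdges := by simp [squareEdges]
  have h13 : ((1 : Fin 4), (3 : Fin 4)) ∈ squareEdges := by simp [squareEdges]
  have h02 : ((0 : Fin 4), (2 : Fin 4)) ∈ squareEdges := by simp [squareEdges]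
  have h23 : ((2 : Fin 4), (3 : Fin 4)) ∈ squareEdges := by simp [squareEdges]
  have h03 : ((0 : Fin 4), (3 : Fin 4)) ∈ squareEdges := by simp [squareEdges]
  have n12 := @hp.not_same_direction _ _ _ _ _ _ h01 h02 (by decide) (by decide) (by decide)
  have n13 := @hp.not_same_direction _ _ _ _ _ _ h01 h03 (by decide) (by decide) (by decide)
  have n23 := @hp.not_same_direction _ _ _ _ _ _ h02 h03 (by decide) (by decide) (by decide)
  obtain ⟨a, ha, hsu⟩ := hslopes _ h01
  obtain ⟨b, hb, hut⟩ := hslopes _ h13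
  obtain ⟨c, hc, hsv⟩ := hslopes _ h02
  obtain ⟨d, hd, hvt⟩ := hslopes _ h23
  obtain ⟨l, hl, hst⟩ := hslopes _ h03
  have ht : p 3 - p 0 = l • ((1 : ℝ), (1 : ℝ)) := by
    rcases hst with h | h | h
    · exact (n13 ha hl (horizontal_of_sub_horizontal ha hb hsu hut h) h).elim
    · exact h
    · exact (n13 ha hl (vertical_of_sub_vertical ha hb hsu hut h) h).elim
  refine ⟨l, hl, by simpa using eq_add_of_sub_eq' ht, ?_⟩
  rcases hsu with hu | hu | hu
  · rcases hsv with hv | hv | hv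
    · exact (n12 ha hc hu hv).elim
    · exact (n23 hc hl hv ht).elim
    · rw [eq_add_right_of_sub_diagonal ha hb hu hut ht, eq_add_up_of_sub_diagonal hc hd hv hvt ht]
  · exact (n13 ha hl hu ht).elim
  · rcases hsv with hv | hv | hv
    · rw [eq_add_up_of_sub_diagonal ha hb hu hut ht, eq_add_right_of_sub_diagonal hc hd hv hvt ht,
        Set.pair_comm]
    · exact (n23 hc hl hv ht).elim
    · exact (n12 ha hc hu hv).elim
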